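/- Suppose φ is Sturmian and of bounded type (every vertex has a finite type set). Then the minimum m = min{τ(x) : x ∈ V(T)} exists, and: (i) the set of values {τ(x) : x ∈ V(T)} equals {n ∈ ℤ : n ≥ m}; (ii) τ(x) = τ(y) implies φ(x) = φ(y), so there is a map ψ from {n ∈ ℤ : n ≥ m} to A with φ(x) = ψ(τ(x)) for all x; (iii) any two adjacent vertices x, y satisfy |τ(x) − τ(y)| ≤ 1. -/

import Mathlib

open SimpleGraph

/-- Equivalence of colored `n`-balls around `x` and `y`: a graph isomorphism between the
induced subgraphs on the balls, sending center to center and preserving the coloring. -/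
def BallEquiv {V A : Type*} (T : SimpleGraph V) (φ : V → A) (n : ℕ) (x y : V) : Prop :=
  ∃ f : {v : V // T.dist x v ≤ n} ≃ {v : V // T.dist y v ≤ n},
    ((f ⟨x, by simp [SimpleGraph.dist_self]⟩ : {v : V // T.dist y v ≤ n}) : V) = y ∧
    (∀ u w : {v : V // T.dist x v ≤ n}, T.Adj (u : V) (w : V) ↔ T.Adj (f u : V) (f w : V)) ∧
    ∀ v : {v : V // T.dist x v ≤ n}, φ (f v : V) = φ (v : V)

/-- Two vertices are in the same class if a color-preserving automorphism of `T`
sends one to the other. -/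
def SameClass {V A : Type*} (T : SimpleGraph V) (φ : V → A) (x y : V) : Prop :=
  ∃ g : V ≃ V, (∀ u w : V, T.Adj (g u) (g w) ↔ T.Adj u w) ∧ g x = y ∧ ∀ v, φ (g v) = φ v

/-- Subword complexity: the number of equivalence classes of colored `n`-balls. -/
noncomputable def ballComplexity {V A : Type*} (T : SimpleGraph V) (φ : V → A) (n : ℕ) : ℕ :=
  Nat.card (Quot (BallEquiv T φ n))

/-- A coloring is periodic if it is invariant under a subgroup of the automorphism group
of `T` having finitely many orbits on vertices. -/
def IsPeriodicColoring {V A : Type*} (T : SimpleGraph V) (φ : V → A) : Prop :=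
  ∃ Γ : Subgroup (Equiv.Perm V),
    (∀ γ ∈ Γ, ∀ u w : V, T.Adj (γ u) (γ w) ↔ T.Adj u w) ∧
    (∀ γ ∈ Γ, ∀ v, φ (γ v) = φ v) ∧
    Finite (Quot (fun x y : V => ∃ γ ∈ Γ, γ x = y))

/-- The colored `n`-ball around `x` is special. -/
def IsSpecial {V A : Type*} (T : SimpleGraph V) (φ : V → A) (n : ℕ) (x : V) : Prop :=
  ∃ y z : V, BallEquiv T φ n x y ∧ BallEquiv T φ n x z ∧ ¬ BallEquiv T φ (n + 1) y z

/-- The type set of a vertex. -/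
def TypeSet {V A : Type*} (T : SimpleGraph V) (φ : V → A) (x : V) : Set ℕ :=
  {n : ℕ | IsSpecial T φ n x}

/-- The maximal type of a vertex of bounded type (`-1` if the type set is empty). -/
noncomputable def maxType {V A : Type*} (T : SimpleGraph V) (φ : V → A) (x : V) : ℤ :=
  sSup (insert (-1) ((fun n : ℕ => (n : ℤ)) '' TypeSet T φ x))

/-- The coloring is Sturmian if its subword complexity is `n + 2`. -/
def IsSturmian {V A : Type*} (T : SimpleGraph V) (φ : V → A) : Prop :=
  ∀ n : ℕ, ballComplexity T φ n = n + 2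

/-- Eventually periodic coloring. -/
def IsEventuallyPeriodic {V A : Type*} (T : SimpleGraph V) (φ : V → A) : Prop :=
  ∃ K : Set V, K.Nonempty ∧ K.Finite ∧ (T.induce K).Connected ∧
    ∀ v : (Kᶜ : Set V), ∃ ψ : V → A, IsPeriodicColoring T ψ ∧
      ∀ w : (Kᶜ : Set V), (T.induce (Kᶜ : Set V)).Reachable v w → ψ (w : V) = φ (w : V)

/-- The vertex set of the `n`-branch from `x` towards its neighbor `x'`. -/
def branchSet {V : Type*} (T : SimpleGraph V) (n : ℕ) (x x' : V) : Set V :=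
  insert x {y : V | T.dist x y ≤ n ∧ T.dist y x' < T.dist y x}

/-- Equivalence of colored `n`-branches. -/
def BranchEquiv {V A : Type*} (T : SimpleGraph V) (φ : V → A) (n : ℕ)
    (x x' y y' : V) : Prop :=
  ∃ f : (branchSet T n x x') ≃ (branchSet T n y y'),
    ((f ⟨x, Set.mem_insert x _⟩ : (branchSet T n y y')) : V) = y ∧
    (∀ u w : (branchSet T n x x'), T.Adj (u : V) (w : V) ↔ T.Adj (f u : V) (f w : V)) ∧
    ∀ v : (branchSet T n x x'), φ (f v : V) = φ (v : V)

/-- A coloring of `K` appears exactly once if the only connected subgraph of `T`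
color-isomorphic to it is `K` itself. -/
def AppearsOnce {V A : Type*} (T : SimpleGraph V) (φ : V → A) (K : Set V) : Prop :=
  ∀ K' : Set V, (T.induce K').Connected →
    (∃ f : K ≃ K', (∀ u w : K, T.Adj (u : V) (w : V) ↔ T.Adj (f u : V) (f w : V)) ∧
      ∀ v : K, φ (f v : V) = φ (v : V)) → K' = K

/-- Color refinement: vertices are `0`-equivalent if they have the same color, and
`(n + 1)`-equivalent if they are `n`-equivalent and their neighbors can be matched up to
`n`-equivalence. -/
def Refine {V A : Type*} (T : SimpleGraph V) (φ : V → A) : ℕ → V → V → Prop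
  | 0, x, y => φ x = φ y
  | n + 1, x, y => Refine T φ n x y ∧
      ∃ σ : T.neighborSet x ≃ T.neighborSet y, ∀ v : T.neighborSet x, Refine T φ n (v : V) (σ v : V)

namespace Refine

variable {V A : Type*} {T : SimpleGraph V} {φ : V → A}

theorem refl (n : ℕ) (x : V) : Refine T φ n x x := by
  induction n generalizing x with
  | zero => rfl
  | succ n ih => exact ⟨ih x, Equiv.refl _, fun v => ih v⟩

theorem symm {n : ℕ} {x y : V} (h : Refine T φ n x y) : Refine T φ n y x := by
  induction n generalizing x y with
  | zero => exact Eq.symm h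
  | succ n ih =>
    obtain ⟨h, σ, hσ⟩ := h
    refine ⟨ih h, σ.symm, fun v => ih ?_⟩
    simpa using hσ (σ.symm v)

theorem trans {n : ℕ} {x y z : V} (h : Refine T φ n x y) (h' : Refine T φ n y z) :
    Refine T φ n x z := by
  induction n generalizing x y z with
  | zero => exact Eq.trans h h'
  | succ n ih =>
    obtain ⟨h, σ, hσ⟩ := h
    obtain ⟨h', τ, hτ⟩ := h'
    exact ⟨ih h h', σ.trans τ, fun v => ih (hσ v) (hτ (σ v))⟩

theorem mono {m n : ℕ} (hmn : m ≤ n) {x y : V} (h : Refine T φ n x y) : Refine T φ m x y := by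
  induction n, hmn using Nat.le_induction with
  | base => exact h
  | succ n _ ih => exact ih h.1

theorem color {n : ℕ} {x y : V} (h : Refine T φ n x y) : φ x = φ y :=
  h.mono (Nat.zero_le n)

/-- The matching of neighbors can be chosen to match a prescribed equivalent pair. -/
theorem exists_equiv_apply_eq {n : ℕ} {x y : V} (h : Refine T φ (n + 1) x y)
    (u : T.neighborSet x) (u' : T.neighborSet y) (hu : Refine T φ n (u : V) (u' : V)) :
    ∃ σ : T.neighborSet x ≃ T.neighborSet y,
      (∀ v : T.neighborSet x, Refine T φ n (v : V) (σ v : V)) ∧ σ u = u' := by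
  classical
  obtain ⟨-, σ, hσ⟩ := h
  refine ⟨σ.trans (Equiv.swap (σ u) u'), fun v => ?_, by simp⟩
  simp only [Equiv.trans_apply, Equiv.swap_apply_def]
  split_ifs with h₁ h₂
  · rwa [σ.injective h₁]
  · have := hσ v
    rw [h₂] at this
    exact (this.trans hu.symm).trans (hσ u)
  · exact hσ v

end Refine

section Ball

variable {V A : Type*} {T : SimpleGraph V} {φ : V → A}

theorem SimpleGraph.Connected.exists_adj_dist_add_one (hT : T.Connected) {x v : V} (h : v ≠ x) :
    ∃ p, T.Adj p v ∧ T.dist x p + 1 = T.dist x v := by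
  obtain ⟨w, hw⟩ := hT.exists_walk_length_eq_dist v x
  cases w with
  | nil => exact absurd rfl h
  | @cons _ p _ hvp w =>
    refine ⟨p, hvp.symm, ?_⟩
    have h₁ := SimpleGraph.dist_le w
    have h₂ := hT.dist_triangle (u := x) (v := p) (w := v)
    have h₃ := SimpleGraph.dist_eq_one_iff_adj.2 hvp.symm
    rw [SimpleGraph.Walk.length_cons, SimpleGraph.dist_comm] at hw
    rw [SimpleGraph.dist_comm] at h₁
    omega

theorem SimpleGraph.IsTree.eq_of_dist_add_one (hT : T.IsTree) {x u v w : V}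
    (hu : T.Adj u w) (hv : T.Adj v w) (hdu : T.dist x u + 1 = T.dist x w)
    (hdv : T.dist x v + 1 = T.dist x w) : u = v := by
  obtain ⟨p, hp⟩ := hT.connected.exists_walk_length_eq_dist x u
  obtain ⟨q, hq⟩ := hT.connected.exists_walk_length_eq_dist x v
  have hp' := (p.concat hu).isPath_of_length_eq_dist (by simp [hp, hdu])
  have hq' := (q.concat hv).isPath_of_length_eq_dist (by simp [hq, hdv])
  have h := congrArg (fun r : T.Path x w => r.1.penultimate)
    ((hT.isAcyclic.subsingleton_path x w).elim ⟨_, hp'⟩ ⟨_, hq'⟩)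
  simpa using h

/-- An adjacency-preserving map of a ball does not increase distances from a vertex, within a
smaller ball around this vertex. -/
theorem dist_map_le_of_adj (hT : T.Connected) {N n : ℕ} {x y v : V}
    (f : {u : V // T.dist x u ≤ N} → {u : V // T.dist y u ≤ N})
    (hf : ∀ u w : {u : V // T.dist x u ≤ N},
      T.Adj (u : V) (w : V) → T.Adj (f u : V) (f w : V))
    (hv : T.dist x v + n ≤ N) (w : V) (hvw : T.dist v w ≤ n) :
    ∃ hw : T.dist x w ≤ N, T.dist (f ⟨v, by omega⟩ : V) (f ⟨w, hw⟩ : V) ≤ T.dist v w := by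
  induction hd : T.dist v w generalizing w with
  | zero =>
    obtain rfl := (hT.dist_eq_zero_iff).1 hd
    exact ⟨by omega, by simp⟩
  | succ j ih =>
    have hne : w ≠ v := by
      rintro rfl
      simp at hd
    obtain ⟨p, hpw, hp⟩ := hT.exists_adj_dist_add_one hne
    obtain ⟨hpN, hpd⟩ := ih p (by omega) (by omega)
    have hwN : T.dist x w ≤ N := by
      have := hT.dist_triangle (u := x) (v := v) (w := w)
      omega
    refine ⟨hwN, ?_⟩
    have h₁ := hT.dist_triangle (u := (f ⟨v, by omega⟩ : V)) (v := (f ⟨p, hpN⟩ : V))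
      (w := (f ⟨w, hwN⟩ : V))
    have h₂ := SimpleGraph.dist_eq_one_iff_adj.2 (hf ⟨p, hpN⟩ ⟨w, hwN⟩ hpw)
    omega

/-- An isomorphism of colored balls restricts to smaller balls around other vertices. -/
theorem BallEquiv.restrict (hT : T.Connected) {N n : ℕ} {x y : V}
    (f : {u : V // T.dist x u ≤ N} ≃ {u : V // T.dist y u ≤ N})
    (hfx : (f ⟨x, by simp [SimpleGraph.dist_self]⟩ : V) = y)
    (hf : ∀ u w : {u : V // T.dist x u ≤ N},
      T.Adj (u : V) (w : V) ↔ T.Adj (f u : V) (f w : V))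
    (hφ : ∀ u : {u : V // T.dist x u ≤ N}, φ (f u : V) = φ (u : V)) (v : {u : V // T.dist x u ≤ N})
    (hv : T.dist x (v : V) + n ≤ N) : BallEquiv T φ n (v : V) (f v : V) := by
  have hf' : ∀ u w : {u : V // T.dist y u ≤ N},
      T.Adj (u : V) (w : V) → T.Adj (f.symm u : V) (f.symm w : V) := by
    intro u w h
    rw [hf]
    simpa using h
  have hfv : T.dist y (f v : V) + n ≤ N := by
    obtain ⟨_, h⟩ := dist_map_le_of_adj hT (n := N) f (fun u w => (hf u w).1)
      (by simp) (v : V) v.2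
    rw [hfx] at h
    exact (Nat.add_le_add_right h n).trans hv
  have h₁ := dist_map_le_of_adj hT f (fun u w => (hf u w).1) hv
  have h₂ := dist_map_le_of_adj hT f.symm hf' hfv
  simp only [Subtype.coe_eta, Equiv.symm_apply_apply] at h₁ h₂
  choose a ha using h₁
  choose b hb using h₂
  refine ⟨⟨fun w => ⟨f ⟨w, a w w.2⟩, (ha w w.2).trans w.2⟩,
    fun w => ⟨f.symm ⟨w, b w w.2⟩, (hb w w.2).trans w.2⟩, fun w => by simp, fun w => by simp⟩,
    rfl, fun u w => hf ⟨u, a u u.2⟩ ⟨w, a w w.2⟩, fun w => hφ _⟩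

theorem BallEquiv.refine (hT : T.Connected) {n : ℕ} {x y : V} (h : BallEquiv T φ n x y) :
    Refine T φ n x y := by
  induction n generalizing x y with
  | zero =>
    obtain ⟨f, hfx, -, hφ⟩ := h
    have := hφ ⟨x, by simp⟩
    rw [hfx] at this
    exact this.symm
  | succ n ih =>
    obtain ⟨f, hfx, hf, hφ⟩ := h
    have hN : ∀ {z u : V}, T.Adj z u → T.dist z u ≤ n + 1 := fun h => by
      rw [SimpleGraph.dist_eq_one_iff_adj.2 h]
      omega
    have hfx' : f.symm ⟨y, by simp⟩ = ⟨x, by simp⟩ := by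
      rw [Equiv.symm_apply_eq]
      exact Subtype.ext hfx.symm
    refine ⟨ih ?_, ⟨fun u => ⟨f ⟨u, hN u.2⟩, ?_⟩, fun u => ⟨f.symm ⟨u, hN u.2⟩, ?_⟩, fun u => by simp,
      fun u => by simp⟩, fun u => ih ?_⟩
    · have := BallEquiv.restrict hT (n := n) f hfx hf hφ ⟨x, by simp⟩ (by simp)
      rwa [hfx] at this
    · have := (hf ⟨x, by simp⟩ ⟨u, hN u.2⟩).1 u.2
      rwa [hfx] at this
    · have h : T.Adj (f.symm ⟨y, by simp⟩ : V) (f.symm ⟨u, hN u.2⟩ : V) := by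
        rw [hf]
        simp only [Equiv.apply_symm_apply]
        exact u.2
      rwa [hfx'] at h
    · refine BallEquiv.restrict hT (n := n) f hfx hf hφ ⟨u, hN u.2⟩ ?_
      simp only [SimpleGraph.dist_eq_one_iff_adj.2 (show T.Adj x u from u.2)]
      omega

end Ball

section Gluing

variable {V A : Type*} {T : SimpleGraph V} {φ : V → A}

/-- A `j`-ball map compatible with the first `n` refinement rounds, defined on all vertices for
convenience. -/
structure IsBallMap (T : SimpleGraph V) (φ : V → A) (n : ℕ) (x y : V) (j : ℕ) (g : V → V) :
    Prop where
  map_center : g x = y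
  dist_eq : ∀ v, T.dist x v ≤ j → T.dist y (g v) = T.dist x v
  refine : ∀ v, T.dist x v ≤ j → Refine T φ (n - T.dist x v) v (g v)
  adj : ∀ u v, T.dist x v ≤ j → T.Adj u v → T.dist x u + 1 = T.dist x v → T.Adj (g u) (g v)
  inj : ∀ u v, T.dist x u ≤ j → T.dist x v ≤ j → g u = g v → u = v
  surj : ∀ w, T.dist y w ≤ j → ∃ v, T.dist x v ≤ j ∧ g v = w

namespace IsBallMap

theorem zero (hT : T.Connected) {n : ℕ} {x y : V} (h : Refine T φ n x y) :
    IsBallMap T φ n x y 0 (fun _ => y) where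
  map_center := rfl
  dist_eq v hv := by simp [Nat.le_zero.1 hv]
  refine v hv := by
    obtain rfl := hT.dist_eq_zero_iff.1 (Nat.le_zero.1 hv)
    simpa using h
  adj u v hv _ h := by omega
  inj u v hu hv _ := (hT.dist_eq_zero_iff.1 (Nat.le_zero.1 hu)).symm.trans
    (hT.dist_eq_zero_iff.1 (Nat.le_zero.1 hv))
  surj w hw := ⟨x, by simp, hT.dist_eq_zero_iff.1 (Nat.le_zero.1 hw)⟩

/-- Around each vertex of the boundary sphere, a ball map extends to the neighbors. -/
theorem exists_local_extension (hT : T.IsTree) {n j : ℕ} (hj : j + 1 ≤ n) {x y : V} {g : V → V}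
    (hg : IsBallMap T φ n x y j g) (p : V) (hp : T.dist x p = j) :
    ∃ s : V → V, (∀ v, T.Adj p v → T.Adj (g p) (s v)) ∧
      (∀ v, T.Adj p v → Refine T φ (n - (j + 1)) v (s v)) ∧
      (∀ u v, T.Adj p u → T.Adj p v → s u = s v → u = v) ∧
      (∀ w, T.Adj (g p) w → ∃ v, T.Adj p v ∧ s v = w) ∧
      (∀ q, T.Adj p q → T.dist x q + 1 = j → s q = g q) := by
  classical
  have hR := hg.refine p hp.le
  rw [hp, show n - j = (n - (j + 1)) + 1 by omega] at hR
  obtain ⟨σ, hσ, hσg⟩ : ∃ σ : T.neighborSet p ≃ T.neighborSet (g p),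
      (∀ v : T.neighborSet p, Refine T φ (n - (j + 1)) (v : V) (σ v : V)) ∧
      ∀ q : T.neighborSet p, T.dist x (q : V) + 1 = j → (σ q : V) = g q := by
    by_cases hpx : p = x
    · obtain ⟨-, σ, hσ⟩ := hR
      refine ⟨σ, hσ, fun q hq => ?_⟩
      subst hpx
      simp at hp
      omega
    · obtain ⟨q, hqp, hq⟩ := hT.connected.exists_adj_dist_add_one hpx
      obtain ⟨σ, hσ, hσq⟩ := hR.exists_equiv_apply_eq ⟨q, hqp.symm⟩
        ⟨g q, (hg.adj q p hp.le hqp hq).symm⟩ ((hg.refine q (by omega)).mono (by omega))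
      refine ⟨σ, hσ, fun r hr => ?_⟩
      obtain rfl : r = ⟨q, hqp.symm⟩ := Subtype.ext
        (hT.eq_of_dist_add_one (x := x) r.2.symm hqp (hr.trans hp.symm) hq)
      rw [hσq]
  refine ⟨fun v => if h : T.Adj p v then σ ⟨v, h⟩ else v, fun v hv => ?_, fun v hv => ?_,
    fun u v hu hv h => ?_, fun w hw => ?_, fun q hq hqj => ?_⟩
  · simp only [hv, dite_true]
    exact (σ ⟨v, hv⟩).2
  · simp only [hv, dite_true]
    exact hσ ⟨v, hv⟩
  · simp only [hu, hv, dite_true] at h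
    exact congrArg Subtype.val (σ.injective (Subtype.ext h))
  · refine ⟨σ.symm ⟨w, hw⟩, (σ.symm ⟨w, hw⟩).2, ?_⟩
    refine (dif_pos (show T.Adj p (σ.symm ⟨w, hw⟩ : V) from (σ.symm ⟨w, hw⟩).2)).trans ?_
    exact congrArg Subtype.val (σ.apply_symm_apply ⟨w, hw⟩)
  · simp only [hq, dite_true]
    exact hσg ⟨q, hq⟩ hqj

theorem exists_succ (hT : T.IsTree) {n j : ℕ} (hj : j + 1 ≤ n) {x y : V} {g : V → V}
    (hg : IsBallMap T φ n x y j g) : ∃ g', IsBallMap T φ n x y (j + 1) g' := by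
  classical
  have hpar : ∀ v, ∃ p, T.dist x v = j + 1 → T.Adj p v ∧ T.dist x p = j := by
    intro v
    by_cases hv : T.dist x v = j + 1
    · have hne : v ≠ x := by
        rintro rfl
        simp at hv
      obtain ⟨p, hp, hd⟩ := hT.connected.exists_adj_dist_add_one hne
      exact ⟨p, fun _ => ⟨hp, by omega⟩⟩
    · exact ⟨v, fun h => absurd h hv⟩
  choose par hpar using hpar
  have hloc := exists_local_extension hT hj hg
  have hloc' : ∀ p, ∃ s : V → V, T.dist x p = j → (∀ v, T.Adj p v → T.Adj (g p) (s v)) ∧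
      (∀ v, T.Adj p v → Refine T φ (n - (j + 1)) v (s v)) ∧
      (∀ u v, T.Adj p u → T.Adj p v → s u = s v → u = v) ∧
      (∀ w, T.Adj (g p) w → ∃ v, T.Adj p v ∧ s v = w) ∧
      (∀ q, T.Adj p q → T.dist x q + 1 = j → s q = g q) := by
    intro p
    by_cases hp : T.dist x p = j
    · obtain ⟨s, hs⟩ := hloc p hp
      exact ⟨s, fun _ => hs⟩
    · exact ⟨id, fun h => absurd h hp⟩
  choose s hs using hloc'
  have hsd : ∀ p v, T.dist x p = j → T.Adj p v → T.dist x v = j + 1 →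
      T.dist y (s p v) = j + 1 := by
    intro p v hp hpv hv
    obtain ⟨h₁, -, h₃, -, h₅⟩ := hs p hp
    have hgp := hg.dist_eq p hp.le
    have hadj := h₁ v hpv
    rcases hT.dist_eq_dist_add_one_of_adj y hadj with h | h
    · exfalso
      have hpx : p ≠ x := by
        rintro rfl
        simp [hg.map_center] at h
      obtain ⟨q, hqp, hq⟩ := hT.connected.exists_adj_dist_add_one hpx
      have hgq := hg.adj q p hp.le hqp hq
      have hdq := hg.dist_eq q (by omega)
      have := hT.eq_of_dist_add_one (x := y) hadj.symm hgq h.symm (by omega)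
      rw [← h₅ q hqp.symm (by omega)] at this
      have := h₃ v q hpv hqp.symm this
      subst this
      omega
    · omega
  have hpu : ∀ p v, T.dist x p = j → T.Adj p v → T.dist x v = j + 1 → par v = p := by
    intro p v hp hpv hv
    obtain ⟨h₁, h₂⟩ := hpar v hv
    exact hT.eq_of_dist_add_one (x := x) h₁ hpv (by omega) (by omega)
  refine ⟨fun v => if T.dist x v = j + 1 then s (par v) v else g v, ?_, ?_, ?_, ?_, ?_, ?_⟩
  · simp [hg.map_center]
  · intro v hv
    split_ifs with h
    · rw [hsd _ _ (hpar v h).2 (hpar v h).1 h, h]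
    · exact hg.dist_eq v (by omega)
  · intro v hv
    split_ifs with h
    · rw [h]
      exact (hs _ (hpar v h).2).2.1 v (hpar v h).1
    · exact hg.refine v (by omega)
  · intro u v hv huv hd
    rw [if_neg (by omega)]
    split_ifs with h
    · rw [hpu u v (by omega) huv h]
      exact (hs u (by omega)).1 v huv
    · exact hg.adj u v (by omega) huv hd
  · intro u v hu hv h
    split_ifs at h with h₁ h₂ h₂
    · obtain ⟨hu₁, hu₂⟩ := hpar u h₁
      obtain ⟨hv₁, hv₂⟩ := hpar v h₂
      have hau := (hs _ hu₂).1 u hu₁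
      have hav := (hs _ hv₂).1 v hv₁
      have hdu := hsd _ _ hu₂ hu₁ h₁
      have h₃ := hg.dist_eq _ hu₂.le
      have h₄ := hg.dist_eq _ hv₂.le
      rw [← h] at hav
      have hgp := hT.eq_of_dist_add_one (x := y) hau hav (by omega) (by omega)
      have hp := hg.inj _ _ hu₂.le hv₂.le hgp
      rw [← hp] at h hv₁
      exact (hs _ hu₂).2.2.1 u v hu₁ hv₁ h
    · have h₃ := hsd _ _ (hpar u h₁).2 (hpar u h₁).1 h₁
      have h₄ := hg.dist_eq v (by omega)
      rw [h] at h₃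
      omega
    · have h₃ := hsd _ _ (hpar v h₂).2 (hpar v h₂).1 h₂
      have h₄ := hg.dist_eq u (by omega)
      rw [← h] at h₃
      omega
    · exact hg.inj u v (by omega) (by omega) h
  · intro w hw
    by_cases h : T.dist y w = j + 1
    · have hne : w ≠ y := by
        rintro rfl
        simp at h
      obtain ⟨q, hqw, hq⟩ := hT.connected.exists_adj_dist_add_one hne
      obtain ⟨p, hpj, rfl⟩ := hg.surj q (by omega)
      have hgp := hg.dist_eq p hpj
      have hp : T.dist x p = j := by omega
      obtain ⟨v, hpv, rfl⟩ := (hs p hp).2.2.2.1 w hqw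
      have hv : T.dist x v = j + 1 := by
        rcases hT.dist_eq_dist_add_one_of_adj x hpv with h' | h'
        · have h₃ := (hs p hp).2.2.2.2 v hpv (by omega)
          have h₄ := hg.dist_eq v (by omega)
          rw [h₃] at h
          omega
        · omega
      exact ⟨v, hv.le, by simp only [hv, if_true, hpu p v hp hpv hv]⟩
    · obtain ⟨v, hv, hvw⟩ := hg.surj w (by omega)
      exact ⟨v, by omega, by rw [if_neg (by omega), hvw]⟩

end IsBallMap

theorem Refine.ballEquiv (hT : T.IsTree) {n : ℕ} {x y : V} (h : Refine T φ n x y) :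
    BallEquiv T φ n x y := by
  have hex : ∀ j, j ≤ n → ∃ g, IsBallMap T φ n x y j g := by
    intro j
    induction j with
    | zero => exact fun _ => ⟨_, IsBallMap.zero hT.connected h⟩
    | succ j ih =>
      intro hj
      obtain ⟨g, hg⟩ := ih (by omega)
      exact hg.exists_succ hT hj
  obtain ⟨g, hg⟩ := hex n le_rfl
  have hback : ∀ u v, T.dist x u ≤ n → T.dist x v ≤ n → T.Adj (g u) (g v) →
      T.dist x u + 1 = T.dist x v → T.Adj u v := by
    intro u v hu hv huv hd
    have hne : v ≠ x := by
      rintro rfl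
      simp at hd
    obtain ⟨p, hpv, hp⟩ := hT.connected.exists_adj_dist_add_one hne
    have h₁ := hg.adj p v hv hpv hp
    have h₂ := hg.dist_eq p (by omega)
    have h₃ := hg.dist_eq u hu
    have h₄ := hg.dist_eq v hv
    have := hT.eq_of_dist_add_one (x := y) h₁ huv (by omega) (by omega)
    rwa [hg.inj p u (by omega) hu this] at hpv
  let f : {v : V // T.dist x v ≤ n} → {v : V // T.dist y v ≤ n} :=
    fun v => ⟨g v, (hg.dist_eq v v.2).trans_le v.2⟩
  have hf : Function.Bijective f := by
    refine ⟨fun u v huv => Subtype.ext (hg.inj u v u.2 v.2 (congrArg Subtype.val huv)),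
      fun w => ?_⟩
    obtain ⟨v, hv, hvw⟩ := hg.surj w w.2
    exact ⟨⟨v, hv⟩, Subtype.ext hvw⟩
  refine ⟨Equiv.ofBijective f hf, hg.map_center, fun u w => ⟨fun huw => ?_, fun huw => ?_⟩,
    fun v => (hg.refine v v.2).color.symm⟩
  · rcases hT.dist_eq_dist_add_one_of_adj x huw with h' | h'
    · exact (hg.adj w u u.2 huw.symm h'.symm).symm
    · exact hg.adj u w w.2 huw h'.symm
  · have hu := hg.dist_eq u u.2
    have hw := hg.dist_eq w w.2
    rcases hT.dist_eq_dist_add_one_of_adj y huw with h' | h'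
    · refine (hback w u w.2 u.2 huw.symm ?_).symm
      change T.dist y (g u) = T.dist y (g w) + 1 at h'
      omega
    · refine hback u w u.2 w.2 huw ?_
      change T.dist y (g w) = T.dist y (g u) + 1 at h'
      omega

theorem ballEquiv_iff_refine (hT : T.IsTree) {n : ℕ} {x y : V} :
    BallEquiv T φ n x y ↔ Refine T φ n x y :=
  ⟨BallEquiv.refine hT.connected, Refine.ballEquiv hT⟩

end Gluing

section Special

variable {V A : Type*} {T : SimpleGraph V} {φ : V → A}

theorem isSpecial_iff_refine (hT : T.IsTree) {n : ℕ} {x : V} : IsSpecial T φ n x ↔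
    ∃ y z, Refine T φ n x y ∧ Refine T φ n x z ∧ ¬ Refine T φ (n + 1) y z := by
  simp only [IsSpecial, ballEquiv_iff_refine hT]

theorem IsSpecial.congr (hT : T.IsTree) {n : ℕ} {x y : V} (hx : IsSpecial T φ n x)
    (h : Refine T φ n x y) : IsSpecial T φ n y := by
  rw [isSpecial_iff_refine hT] at hx ⊢
  obtain ⟨u, v, hu, hv, huv⟩ := hx
  exact ⟨u, v, h.symm.trans hu, h.symm.trans hv, huv⟩

theorem Refine.succ_of_not_isSpecial (hT : T.IsTree) {n : ℕ} {x y : V}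
    (h : Refine T φ n x y) (hx : ¬ IsSpecial T φ n x) : Refine T φ (n + 1) x y := by
  by_contra hxy
  exact hx ((isSpecial_iff_refine hT).2 ⟨x, y, Refine.refl n x, h, hxy⟩)

theorem Refine.of_forall_not_isSpecial (hT : T.IsTree) {m n : ℕ} (hmn : m ≤ n) {x y : V}
    (h : Refine T φ m x y) (hx : ∀ j, m ≤ j → j < n → ¬ IsSpecial T φ j x) :
    Refine T φ n x y := by
  induction n, hmn using Nat.le_induction with
  | base => exact h
  | succ n hmn ih =>
    exact (ih fun j hj hjn => hx j hj (by omega)).succ_of_not_isSpecial hT (hx n hmn (by omega))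

theorem Refine.forall_of_forall_not_isSpecial (hT : T.IsTree) {m : ℕ} {x y : V}
    (h : Refine T φ m x y) (hx : ∀ j, m ≤ j → ¬ IsSpecial T φ j x) (n : ℕ) :
    Refine T φ n x y := by
  rcases le_total m n with hmn | hmn
  · exact h.of_forall_not_isSpecial hT hmn fun j hj _ => hx j hj
  · exact h.mono hmn

/-- A special `(n + 1)`-ball has a special `n`-ball around a neighbor of its center. -/
theorem IsSpecial.exists_adj (hT : T.IsTree) {n : ℕ} {x : V} (hx : IsSpecial T φ (n + 1) x) :
    ∃ u, T.Adj u x ∧ IsSpecial T φ n u := by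
  by_contra! hcon
  obtain ⟨y, z, hy, hz, hyz⟩ := (isSpecial_iff_refine hT).1 hx
  have h := hy.symm.trans hz
  obtain ⟨-, τ, hτ⟩ := hy.symm
  obtain ⟨-, σ, hσ⟩ := id h
  refine hyz ⟨h, σ, fun v => (hσ v).succ_of_not_isSpecial hT fun hv => ?_⟩
  exact hcon (τ v) (τ v).2.symm (hv.congr hT (hτ v))

/-- The setoid of `n`-equivalence. -/
def refineSetoid (T : SimpleGraph V) (φ : V → A) (n : ℕ) : Setoid V where
  r := Refine T φ n
  iseqv := ⟨Refine.refl n, Refine.symm, Refine.trans⟩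

/-- The setoid of vertices which are `n`-equivalent for all `n`. -/
def refineSetoidTop (T : SimpleGraph V) (φ : V → A) : Setoid V where
  r x y := ∀ n, Refine T φ n x y
  iseqv := ⟨fun x n => Refine.refl n x, fun h n => (h n).symm, fun h h' n => (h n).trans (h' n)⟩

theorem IsSturmian.card_quotient (hT : T.IsTree) (hst : IsSturmian T φ) (n : ℕ) :
    Nat.card (Quotient (refineSetoid T φ n)) = n + 2 := by
  rw [← hst n, ballComplexity, show BallEquiv T φ n = Refine T φ n from
    funext₂ fun x y => propext (ballEquiv_iff_refine hT)]
  rfl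

theorem IsSturmian.finite_quotient (hT : T.IsTree) (hst : IsSturmian T φ) (n : ℕ) :
    Finite (Quotient (refineSetoid T φ n)) :=
  Nat.finite_of_card_ne_zero (by rw [hst.card_quotient hT]; omega)

theorem IsSturmian.exists_isSpecial (hT : T.IsTree) (hst : IsSturmian T φ) (n : ℕ) :
    ∃ x, IsSpecial T φ n x := by
  by_contra! hcon
  have := hst.finite_quotient hT n
  have h := Nat.card_le_card_of_surjective
    (Quotient.lift (s := refineSetoid T φ n) (fun x => Quotient.mk (refineSetoid T φ (n + 1)) x)
      fun x y hxy => Quotient.sound (Refine.succ_of_not_isSpecial hT hxy (hcon x)))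
    (fun q => Quotient.inductionOn q fun x => ⟨Quotient.mk _ x, rfl⟩)
  rw [hst.card_quotient hT, hst.card_quotient hT] at h
  omega

/-- In a Sturmian coloring, the special `n`-ball is unique. -/
theorem IsSturmian.refine_of_isSpecial (hT : T.IsTree) (hst : IsSturmian T φ) {n : ℕ} {x x' : V}
    (hx : IsSpecial T φ n x) (hx' : IsSpecial T φ n x') : Refine T φ n x x' := by
  classical
  by_contra hxx
  obtain ⟨y, z, hy, hz, hyz⟩ := (isSpecial_iff_refine hT).1 hx
  obtain ⟨y', z', hy', hz', hyz'⟩ := (isSpecial_iff_refine hT).1 hx'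
  have := hst.finite_quotient hT n
  have := hst.finite_quotient hT (n + 1)
  have := Fintype.ofFinite (Quotient (refineSetoid T φ n))
  have := Fintype.ofFinite (Quotient (refineSetoid T φ (n + 1)))
  let mk : V → Quotient (refineSetoid T φ (n + 1)) := Quotient.mk _
  let π : Quotient (refineSetoid T φ (n + 1)) → Quotient (refineSetoid T φ n) :=
    Quotient.lift (s := refineSetoid T φ (n + 1)) (fun x => Quotient.mk (refineSetoid T φ n) x)
      fun x y hxy => Quotient.sound (Refine.mono (Nat.le_succ n) hxy)
  have hmk : ∀ {u v}, mk u = mk v ↔ Refine T φ (n + 1) u v := Quotient.eq (r := refineSetoid T φ _)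
  have hne : ∀ {u u'}, Refine T φ n x u → Refine T φ n x' u' → mk u ≠ mk u' := fun hu hu' h =>
    hxx ((hu.trans (Refine.mono (Nat.le_succ n) (hmk.1 h))).trans hu'.symm)
  have hsurj : (Finset.univ : Finset (Quotient (refineSetoid T φ n))) ⊆
      ((Finset.univ.erase (mk z)).erase (mk z')).image π := by
    intro q _
    obtain ⟨w, rfl⟩ := Quotient.exists_rep q
    rw [Finset.mem_image]
    by_cases h₁ : mk w = mk z
    · refine ⟨mk y, ?_, Quotient.sound (s := refineSetoid T φ n)
        ((hy.symm.trans hz).trans (Refine.mono (Nat.le_succ n) (hmk.1 h₁)).symm)⟩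
      simp only [Finset.mem_erase, Finset.mem_univ, and_true]
      exact ⟨hne hy hz', fun h => hyz (hmk.1 h)⟩
    by_cases h₂ : mk w = mk z'
    · refine ⟨mk y', ?_, Quotient.sound (s := refineSetoid T φ n)
        ((hy'.symm.trans hz').trans (Refine.mono (Nat.le_succ n) (hmk.1 h₂)).symm)⟩
      simp only [Finset.mem_erase, Finset.mem_univ, and_true]
      exact ⟨fun h => hyz' (hmk.1 h), (hne hz hy').symm⟩
    · exact ⟨mk w, by simp [h₁, h₂], rfl⟩
  have h := (Finset.card_le_card hsurj).trans Finset.card_image_le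
  rw [Finset.card_erase_of_mem (by simpa using (hne hz hz').symm),
    Finset.card_erase_of_mem (Finset.mem_univ _), Finset.card_univ, Finset.card_univ,
    ← Nat.card_eq_fintype_card, ← Nat.card_eq_fintype_card, hst.card_quotient hT,
    hst.card_quotient hT] at h
  omega

/-- A set of vertices meeting only finitely many classes. -/
def HasFinitelyManyClasses (T : SimpleGraph V) (φ : V → A) (Z : Set V) : Prop :=
  (Quotient.mk (refineSetoidTop T φ) '' Z).Finite

theorem hasFinitelyManyClasses_setOf_refine (x : V) :
    HasFinitelyManyClasses T φ {w | ∀ n, Refine T φ n x w} :=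
  (Set.finite_singleton (Quotient.mk (refineSetoidTop T φ) x)).subset <| by
    rintro _ ⟨w, hw, rfl⟩
    exact (Quotient.sound (s := refineSetoidTop T φ) hw).symm

/-- Vertices which are equivalent at all levels have the same classes of neighbors. -/
theorem exists_adj_forall_refine {x w z : V} (hfin : (T.neighborSet x).Finite)
    (h : ∀ n, Refine T φ n x w) (hz : T.Adj w z) : ∃ y, T.Adj x y ∧ ∀ n, Refine T φ n y z := by
  by_contra! hcon
  choose! M hM using hcon
  obtain ⟨K, hK⟩ := (hfin.image M).bddAbove
  obtain ⟨-, σ, hσ⟩ := (h (K + 1)).symm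
  have hy := (σ ⟨z, hz⟩).2
  exact hM _ hy ((hσ ⟨z, hz⟩).symm.mono (hK ⟨_, hy, rfl⟩))

theorem HasFinitelyManyClasses.of_adj (hfin : ∀ x, (T.neighborSet x).Finite) {Z W : Set V}
    (hZ : HasFinitelyManyClasses T φ Z) (hW : ∀ w ∈ W, ∃ z ∈ Z, T.Adj z w) :
    HasFinitelyManyClasses T φ W := by
  let r : V → V := fun z => (Quotient.mk (refineSetoidTop T φ) z).out
  have hr : (r '' Z).Finite := by
    have := hZ.image Quotient.out
    rwa [Set.image_image] at this
  refine ((hr.biUnion fun z _ => hfin z).image (Quotient.mk (refineSetoidTop T φ))).subset ?_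
  rintro _ ⟨w, hw, rfl⟩
  obtain ⟨z, hz, hzw⟩ := hW w hw
  obtain ⟨y, hy, hyw⟩ := exists_adj_forall_refine (hfin (r z))
    (Quotient.mk_out (s := refineSetoidTop T φ) z) hzw
  exact ⟨y, Set.mem_biUnion (Set.mem_image_of_mem r hz) hy,
    Quotient.sound (s := refineSetoidTop T φ) hyw⟩

theorem IsSturmian.not_hasFinitelyManyClasses_univ (hT : T.IsTree) (hst : IsSturmian T φ) :
    ¬ HasFinitelyManyClasses T φ Set.univ := by
  intro h
  have : Finite (Quotient (refineSetoidTop T φ)) := by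
    rw [HasFinitelyManyClasses, Set.image_univ, Set.range_eq_univ.2 Quotient.mk_surjective] at h
    exact Set.finite_univ_iff.1 h
  have hle := Nat.card_le_card_of_surjective
    (Quotient.lift (s := refineSetoidTop T φ)
      (fun x => Quotient.mk (refineSetoid T φ (Nat.card (Quotient (refineSetoidTop T φ)))) x)
      fun x y hxy => Quotient.sound (hxy _))
    (fun q => Quotient.inductionOn q fun x => ⟨Quotient.mk _ x, rfl⟩)
  rw [hst.card_quotient hT] at hle
  omega

/-- If only finitely many classes are special at some level, then there are only finitely many
classes. -/
theorem IsSturmian.not_hasFinitelyManyClasses_isSpecial (hT : T.IsTree) (hst : IsSturmian T φ)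
    (hfin : ∀ x, (T.neighborSet x).Finite) (m : ℕ) :
    ¬ HasFinitelyManyClasses T φ {z | IsSpecial T φ m z} := by
  classical
  intro hm
  have hall : ∀ j, m ≤ j → HasFinitelyManyClasses T φ {z | IsSpecial T φ j z} := by
    intro j hj
    induction j, hj using Nat.le_induction with
    | base => exact hm
    | succ j _ ih =>
      refine ih.of_adj hfin fun w hw => ?_
      obtain ⟨u, hu, hus⟩ := IsSpecial.exists_adj hT hw
      exact ⟨u, hus, hu⟩
  have hcell : ∀ v, HasFinitelyManyClasses T φ {w | Refine T φ m v w} := by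
    intro v
    by_cases hv : ∃ j, m ≤ j ∧ IsSpecial T φ j v
    · obtain ⟨hj, hs⟩ := Nat.find_spec hv
      refine (hall _ hj).subset (Set.image_mono fun w hw => ?_)
      exact hs.congr hT (Refine.of_forall_not_isSpecial hT hj hw
        fun i hi hlt his => Nat.find_min hv hlt ⟨hi, his⟩)
    · push Not at hv
      exact (hasFinitelyManyClasses_setOf_refine v).subset (Set.image_mono fun w hw =>
        Refine.forall_of_forall_not_isSpecial hT hw hv)
  have := hst.finite_quotient hT m
  refine hst.not_hasFinitelyManyClasses_univ hT
    ((Set.finite_iUnion fun q : Quotient (refineSetoid T φ m) => hcell q.out).subset ?_)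
  rintro _ ⟨w, -, rfl⟩
  exact Set.mem_iUnion.2 ⟨Quotient.mk _ w, w, Quotient.mk_out (s := refineSetoid T φ m) w, rfl⟩

/-- A neighbor of a vertex without special balls of radius at least `m` has no special ball of
radius `m + 1`. -/
theorem IsSturmian.not_isSpecial_of_adj (hT : T.IsTree) (hst : IsSturmian T φ)
    (hfin : ∀ x, (T.neighborSet x).Finite) {m : ℕ} {x y : V} (hxy : T.Adj x y)
    (hx : ∀ j, m ≤ j → ¬ IsSpecial T φ j x) : ¬ IsSpecial T φ (m + 1) y := by
  intro hy
  refine hst.not_hasFinitelyManyClasses_isSpecial hT hfin (m + 1)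
    ((hasFinitelyManyClasses_setOf_refine x).of_adj hfin fun z hz => ?_)
  obtain ⟨-, σ, hσ⟩ := hst.refine_of_isSpecial hT hy hz
  exact ⟨σ ⟨x, hxy.symm⟩, Refine.forall_of_forall_not_isSpecial hT (hσ ⟨x, hxy.symm⟩) hx,
    (σ ⟨x, hxy.symm⟩).2.symm⟩

end Special

section MaxType

variable {V A : Type*} {T : SimpleGraph V} {φ : V → A} {x : V}

theorem isGreatest_maxType (hx : (TypeSet T φ x).Finite) :
    IsGreatest (insert (-1) ((fun n : ℕ => (n : ℤ)) '' TypeSet T φ x)) (maxType T φ x) := by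
  have hfin := (hx.image (fun n : ℕ => (n : ℤ))).insert (-1)
  exact ⟨(Set.insert_nonempty _ _).csSup_mem hfin, fun n hn => le_csSup hfin.bddAbove hn⟩

theorem le_maxType (hx : (TypeSet T φ x).Finite) {n : ℕ} (hn : IsSpecial T φ n x) :
    (n : ℤ) ≤ maxType T φ x :=
  (isGreatest_maxType hx).2 (Set.mem_insert_of_mem _ ⟨n, hn, rfl⟩)

theorem neg_one_le_maxType (hx : (TypeSet T φ x).Finite) : -1 ≤ maxType T φ x :=
  (isGreatest_maxType hx).2 (Set.mem_insert _ _)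

theorem isSpecial_of_maxType_eq (hx : (TypeSet T φ x).Finite) {n : ℕ}
    (hn : maxType T φ x = n) : IsSpecial T φ n x := by
  rcases (isGreatest_maxType hx).1 with h | ⟨j, hj, h⟩
  · omega
  · obtain rfl : j = n := Int.ofNat_inj.1 (h.trans hn)
    exact hj

theorem IsSturmian.maxType_le_of_adj (hT : T.IsTree) (hst : IsSturmian T φ)
    (hfin : ∀ x, (T.neighborSet x).Finite) (hbd : ∀ v, (TypeSet T φ v).Finite) {x y : V}
    (hxy : T.Adj x y) : maxType T φ y ≤ maxType T φ x + 1 := by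
  by_contra! hlt
  have hx := neg_one_le_maxType (hbd x)
  obtain ⟨n, hn⟩ : ∃ n : ℕ, maxType T φ y = (n + 1 : ℕ) :=
    ⟨(maxType T φ y - 1).toNat, by omega⟩
  refine hst.not_isSpecial_of_adj hT hfin hxy (m := n) (fun j hj hjx => ?_)
    (isSpecial_of_maxType_eq (hbd y) hn)
  have := le_maxType (hbd x) hjx
  omega

theorem IsSturmian.refine_zero_of_not_isSpecial (hT : T.IsTree) (hst : IsSturmian T φ) {x y : V}
    (hx : ¬ IsSpecial T φ 0 x) (hy : ¬ IsSpecial T φ 0 y) : Refine T φ 0 x y := by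
  classical
  by_contra hxy
  obtain ⟨s, hs⟩ := hst.exists_isSpecial hT 0
  have := hst.finite_quotient hT 0
  have := Fintype.ofFinite (Quotient (refineSetoid T φ 0))
  have hmk : ∀ {u v}, Quotient.mk (refineSetoid T φ 0) u = Quotient.mk _ v ↔ Refine T φ 0 u v :=
    Quotient.eq (r := refineSetoid T φ 0)
  have hcard := Finset.card_le_univ {Quotient.mk (refineSetoid T φ 0) s,
    Quotient.mk (refineSetoid T φ 0) x, Quotient.mk (refineSetoid T φ 0) y}
  rw [Finset.card_eq_three.2 ⟨_, _, _, fun h => hx (hs.congr hT (hmk.1 h)),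
    fun h => hy (hs.congr hT (hmk.1 h)), fun h => hxy (hmk.1 h), rfl⟩,
    ← Nat.card_eq_fintype_card, hst.card_quotient hT] at hcard
  omega

theorem IsSturmian.color_eq_of_maxType_eq (hT : T.IsTree) (hst : IsSturmian T φ)
    (hbd : ∀ v, (TypeSet T φ v).Finite) {x y : V} (h : maxType T φ x = maxType T φ y) :
    φ x = φ y := by
  by_cases hx : 0 ≤ maxType T φ x
  · obtain ⟨n, hn⟩ := Int.eq_ofNat_of_zero_le hx
    exact (hst.refine_of_isSpecial hT (isSpecial_of_maxType_eq (hbd x) hn)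
      (isSpecial_of_maxType_eq (hbd y) (h.symm.trans hn))).color
  · refine (hst.refine_zero_of_not_isSpecial hT (fun hs => ?_) fun hs => ?_).color
    · exact hx (le_maxType (hbd x) hs)
    · exact hx (h ▸ le_maxType (hbd y) hs)

/-- An integer-valued function increasing by at most one along edges has no gaps on a walk. -/
theorem SimpleGraph.Walk.exists_apply_eq_of_adj_le {f : V → ℤ}
    (hf : ∀ u v, T.Adj u v → f v ≤ f u + 1) {u v : V} (p : T.Walk u v) {n : ℤ} (hu : f u ≤ n)
    (hv : n ≤ f v) : ∃ w, f w = n := by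
  induction p with
  | nil => exact ⟨_, le_antisymm hu hv⟩
  | @cons u w _ h p ih =>
    rcases hu.eq_or_lt with hu | hu
    · exact ⟨u, hu⟩
    · exact ih (by have := hf u w h; omega) hv

end MaxType

theorem stmt_13 {V A : Type*} (T : SimpleGraph V) (φ : V → A) (k : ℕ)
    (hk : 2 ≤ k) (htree : T.IsTree) (hreg : ∀ v : V, (T.neighborSet v).ncard = k)
    (hst : IsSturmian T φ) (hbd : ∀ v : V, (TypeSet T φ v).Finite) :
    ∃ m : ℤ, IsLeast (Set.range (maxType T φ)) m ∧
      Set.range (maxType T φ) = {n : ℤ | m ≤ n} ∧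
      (∀ x y : V, maxType T φ x = maxType T φ y → φ x = φ y) ∧
      (∃ ψ : ℤ → A, ∀ x : V, φ x = ψ (maxType T φ x)) ∧
      (∀ x y : V, T.Adj x y → |maxType T φ x - maxType T φ y| ≤ 1) := by
  have hfin : ∀ x, (T.neighborSet x).Finite := fun x =>
    Set.finite_of_ncard_ne_zero (by rw [hreg]; omega)
  have hstep : ∀ x y, T.Adj x y → maxType T φ y ≤ maxType T φ x + 1 := fun x y hxy =>
    hst.maxType_le_of_adj htree hfin hbd hxy
  obtain ⟨x₀⟩ := htree.connected.nonempty
  obtain ⟨m, ⟨x₁, hx₁⟩, hm⟩ := Int.exists_least_of_bdd (P := fun n => ∃ x, maxType T φ x = n)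
    ⟨-1, by rintro _ ⟨x, rfl⟩; exact neg_one_le_maxType (hbd x)⟩ ⟨_, x₀, rfl⟩
  have hcolor : ∀ x y, maxType T φ x = maxType T φ y → φ x = φ y := fun x y h =>
    hst.color_eq_of_maxType_eq htree hbd h
  refine ⟨m, ⟨⟨x₁, hx₁⟩, fun n hn => hm n hn⟩, ?_, hcolor, ?_, fun x y hxy => ?_⟩
  · refine Set.Subset.antisymm (fun n hn => hm n hn) fun n (hn : m ≤ n) => ?_
    obtain ⟨z, hz⟩ := hst.exists_isSpecial htree n.toNat
    have hnz := le_maxType (hbd z) hz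
    obtain ⟨p⟩ := htree.connected x₁ z
    exact p.exists_apply_eq_of_adj_le hstep (hx₁.trans_le hn) (by omega)
  · refine ⟨Function.extend (maxType T φ) φ fun _ => φ x₀, fun x => ?_⟩
    have hfac : Function.FactorsThrough φ (maxType T φ) := fun x y h => hcolor x y h
    exact (hfac.extend_apply _ x).symm
  · have h₁ := hstep x y hxy
    have h₂ := hstep y x hxy.symm
    rw [abs_le]
    omega
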